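/- Every minimal topological dynamical system in which every point is generic for some invariant measure is uniquely ergodic. -/

import Mathlib

open MeasureTheory Filter Topology Metric

section TopDefs

variable {X : Type*} [MetricSpace X]

/-- The Cesàro (Birkhoff) averages `(1/n) ∑_{i<n} f(Tⁱ x)`. -/
noncomputable def cesaro (T : X → X) (f : X → ℝ) (n : ℕ) (x : X) : ℝ :=
  (n : ℝ)⁻¹ * ∑ i ∈ Finset.range n, f (T^[i] x)

/-- `P` is a partition of `X` (into nonempty sets, every point in exactly one atom). -/
def IsPartition (P : Set (Set X)) : Prop :=
  (∀ A ∈ P, A.Nonempty) ∧ ∀ x : X, ∃! A : Set X, A ∈ P ∧ x ∈ A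

/-- A partition is upper semicontinuous if whenever a sequence of atoms converges in the
Hausdorff metric to a (nonempty compact) set `S`, then `S` is contained in some atom. -/
def PartitionUSC (P : Set (Set X)) : Prop :=
  ∀ A : ℕ → Set X, (∀ n, A n ∈ P) → ∀ S : Set X, S.Nonempty → IsCompact S →
    Tendsto (fun n => hausdorffDist (A n) S) atTop (𝓝 0) → ∃ B ∈ P, S ⊆ B

/-- A partition is lower semicontinuous if whenever a sequence of atoms converges in the
Hausdorff metric to a (nonempty compact) set `S`, then `S` contains some atom. -/
def PartitionLSC (P : Set (Set X)) : Prop :=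
  ∀ A : ℕ → Set X, (∀ n, A n ∈ P) → ∀ S : Set X, S.Nonempty → IsCompact S →
    Tendsto (fun n => hausdorffDist (A n) S) atTop (𝓝 0) → ∃ B ∈ P, B ⊆ S

/-- Upper semicontinuity of a (compact-)set-valued function: if `yₙ → y₀` and
`f(yₙ) → S` in the Hausdorff metric, then `S ⊆ f(y₀)`. -/
def SetValuedUSC {Y : Type*} [MetricSpace Y] (f : Y → Set X) : Prop :=
  ∀ (y : ℕ → Y) (y₀ : Y), Tendsto y atTop (𝓝 y₀) →
    ∀ S : Set X, S.Nonempty → IsCompact S →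
      Tendsto (fun n => hausdorffDist (f (y n)) S) atTop (𝓝 0) → S ⊆ f y₀

/-- Lower semicontinuity of a (compact-)set-valued function: if `yₙ → y₀` and
`f(yₙ) → S` in the Hausdorff metric, then `f(y₀) ⊆ S`. -/
def SetValuedLSC {Y : Type*} [MetricSpace Y] (f : Y → Set X) : Prop :=
  ∀ (y : ℕ → Y) (y₀ : Y), Tendsto y atTop (𝓝 y₀) →
    ∀ S : Set X, S.Nonempty → IsCompact S →
      Tendsto (fun n => hausdorffDist (f (y n)) S) atTop (𝓝 0) → f y₀ ⊆ S

/-- A set is invariant for the homeomorphism `T` if `T(K) = K`. -/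
def IsInvariantSet (T : X ≃ₜ X) (K : Set X) : Prop := T '' K = K

/-- A minimal set: nonempty, closed, invariant, with no proper nonempty closed invariant
subset. -/
def IsMinimalSet (T : X ≃ₜ X) (K : Set X) : Prop :=
  K.Nonempty ∧ IsClosed K ∧ IsInvariantSet T K ∧
    ∀ K' : Set X, K' ⊆ K → K'.Nonempty → IsClosed K' → IsInvariantSet T K' → K' = K

/-- A system is semi-simple if `X` is a union of minimal sets. -/
def SemiSimple (T : X ≃ₜ X) : Prop :=
  ∀ x : X, ∃ K : Set X, IsMinimalSet T K ∧ x ∈ K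

/-- A system is uniform if the Cesàro means of every continuous function converge
uniformly on `X`. -/
def UniformSystem (T : X ≃ₜ X) : Prop :=
  ∀ f : C(X, ℝ), ∃ g : X → ℝ,
    TendstoUniformly (fun n x => cesaro (⇑T) (⇑f) n x) g atTop

/-- Uniformity of the subsystem carried by the set `M`: the Cesàro means of every
continuous function converge uniformly on `M`. -/
def UniformOn (T : X ≃ₜ X) (M : Set X) : Prop :=
  ∀ f : C(X, ℝ), ∃ g : X → ℝ,
    TendstoUniformlyOn (fun n x => cesaro (⇑T) (⇑f) n x) g atTop M

/-- Strictly uniform = uniform + semi-simple. -/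
def StrictlyUniform (T : X ≃ₜ X) : Prop := UniformSystem T ∧ SemiSimple T

end TopDefs

section MeasDefs

variable {X : Type*} [MetricSpace X] [CompactSpace X]
  [MeasurableSpace X] [BorelSpace X]

/-- A `T`-invariant Borel probability measure. -/
def IsInvariantMeasure (T : X ≃ₜ X) (μ : ProbabilityMeasure X) : Prop :=
  μ.toMeasure.map ⇑T = μ.toMeasure

/-- An ergodic `T`-invariant Borel probability measure. -/
def IsErgodicMeasure (T : X ≃ₜ X) (μ : ProbabilityMeasure X) : Prop :=
  Ergodic (⇑T) μ.toMeasure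

/-- `x` is generic for `μ`: the Cesàro means of every continuous function at `x`
converge to the integral of the function against `μ`. -/
def IsGenericFor (T : X ≃ₜ X) (x : X) (μ : ProbabilityMeasure X) : Prop :=
  ∀ f : C(X, ℝ),
    Tendsto (fun n => cesaro (⇑T) (⇑f) n x) atTop (𝓝 (∫ y, f y ∂μ.toMeasure))

/-- Pointwise ergodic: every point is generic for some ergodic measure. -/
def PointwiseErgodic (T : X ≃ₜ X) : Prop :=
  ∀ x : X, ∃ μ : ProbabilityMeasure X, IsErgodicMeasure T μ ∧ IsGenericFor T x μ

/-- The set of points generic for `μ` (a fiber of the map `Φ`). -/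
def genericFiber (T : X ≃ₜ X) (μ : ProbabilityMeasure X) : Set X :=
  {x : X | IsGenericFor T x μ}

/-- The generic-point partition `𝒫`: the (nonempty) fibers of the map `Φ` sending each
point to the ergodic measure it generates. -/
def genericPartition (T : X ≃ₜ X) : Set (Set X) :=
  {A : Set X | ∃ μ : ProbabilityMeasure X, IsErgodicMeasure T μ ∧
    (genericFiber T μ).Nonempty ∧ A = genericFiber T μ}

/-- Continuously pointwise ergodic: every point is generic for an ergodic measure and the
map `Φ` sending each point to that measure is continuous (weak-star topology). -/
def ContinuouslyPointwiseErgodic (T : X ≃ₜ X) : Prop :=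
  ∃ Φ : X → ProbabilityMeasure X, Continuous Φ ∧
    ∀ x : X, IsErgodicMeasure T (Φ x) ∧ IsGenericFor T x (Φ x)

/-- Continuously strictly pointwise ergodic = continuously pointwise ergodic +
semi-simple. -/
def ContinuouslyStrictlyPointwiseErgodic (T : X ≃ₜ X) : Prop :=
  ContinuouslyPointwiseErgodic T ∧ SemiSimple T

/-- The set `K` carries exactly one `T`-invariant Borel probability measure. -/
def UniquelyErgodicOn (T : X ≃ₜ X) (K : Set X) : Prop :=
  ∃! μ : ProbabilityMeasure X, IsInvariantMeasure T μ ∧ μ.toMeasure K = 1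

/-- Partitionable: `X` is a disjoint union of closed invariant uniquely ergodic sets. -/
def Partitionable (T : X ≃ₜ X) : Prop :=
  ∃ P : Set (Set X), IsPartition P ∧
    ∀ K ∈ P, IsClosed K ∧ IsInvariantSet T K ∧ UniquelyErgodicOn T K

/-- Strictly partitionable: `X` is a union of strictly ergodic (minimal and uniquely
ergodic) subsystems. -/
def StrictlyPartitionable (T : X ≃ₜ X) : Prop :=
  ∀ x : X, ∃ K : Set X, x ∈ K ∧ IsMinimalSet T K ∧ UniquelyErgodicOn T K

/-- The topological support of a measure: points all of whose open neighborhoods have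
positive measure (equivalently, the smallest closed set of full measure). -/
def msupp (μ : ProbabilityMeasure X) : Set X :=
  {x : X | ∀ U : Set X, IsOpen U → x ∈ U → 0 < μ.toMeasure U}

/-- The set `ℳ_T^e(X)` of ergodic invariant probability measures. -/
def ErgodicSet (T : X ≃ₜ X) : Set (ProbabilityMeasure X) :=
  {μ : ProbabilityMeasure X | IsErgodicMeasure T μ}

/-- Continuity of the set-valued map `supp : ℳ_T^e(X) → 2^X` (sequentially, via the
Hausdorff metric; `ℳ_T^e(X)` carries the weak-star topology, which is metrizable). -/
def SuppContinuousOnErgodic (T : X ≃ₜ X) : Prop :=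
  ∀ μ ∈ ErgodicSet T, ∀ ν : ℕ → ProbabilityMeasure X,
    (∀ n, ν n ∈ ErgodicSet T) → Tendsto ν atTop (𝓝 μ) →
    Tendsto (fun n => hausdorffDist (msupp (ν n)) (msupp μ)) atTop (𝓝 0)

end MeasDefs
lemma cesaro_eq_birkhoff {X : Type*} (T : X → X) [MetricSpace X] (f : X → ℝ) (n : ℕ) (x : X) :
    cesaro T f n x = birkhoffAverage ℝ T f n x := by
  simp [cesaro, birkhoffAverage, birkhoffSum]

lemma cesaro_cont {X : Type*} [MetricSpace X] (T : X ≃ₜ X) (f : C(X, ℝ)) (n : ℕ) :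
    Continuous (cesaro (⇑T) (⇑f) n) := by
  unfold cesaro
  refine continuous_const.mul (continuous_finset_sum _ fun i _ => ?_)
  exact f.continuous.comp (T.continuous.iterate i)

lemma lim_invariant {X : Type*} [MetricSpace X] [CompactSpace X] (T : X ≃ₜ X) (f : C(X, ℝ))
    (g : X → ℝ) (hg : ∀ x, Tendsto (fun n => cesaro (⇑T) (⇑f) n x) atTop (𝓝 (g x))) (x : X) :
    g (T x) = g x := by
  have hb : Bornology.IsBounded (Set.range (⇑f)) := (isCompact_range f.continuous).isBounded
  have h := tendsto_birkhoffAverage_apply_sub_birkhoffAverage' ℝ hb (⇑T) x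
  have h2 := (hg (T x)).sub (hg x)
  simp only [cesaro_eq_birkhoff] at h2
  have := tendsto_nhds_unique h2 h
  linarith

lemma lim_dense {X : Type*} [MetricSpace X] [CompactSpace X] (T : X ≃ₜ X)
    (hmin : ∀ K : Set X, IsClosed K → IsInvariantSet T K → K = ∅ ∨ K = Set.univ)
    (g : X → ℝ) (hg : ∀ x, g (T x) = g x) (x : X) : Dense {z | g z = g x} := by
  have h := hmin (closure {z | g z = g x}) isClosed_closure (by
    unfold IsInvariantSet
    rw [T.image_closure]
    congr 1
    ext z
    constructor
    · rintro ⟨w, hw, rfl⟩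
      simpa [hg] using hw
    · intro hz
      refine ⟨T.symm z, ?_, by simp⟩
      have := hg (T.symm z)
      simp only [T.apply_symm_apply] at this
      simpa [← this] using hz)
  rcases h with h | h
  · exact absurd (subset_closure (show x ∈ {z | g z = g x} from rfl)) (by simp [h])
  · exact dense_iff_closure_eq.2 h

lemma lim_const {X : Type*} [MetricSpace X] [CompactSpace X] (T : X ≃ₜ X)
    (hmin : ∀ K : Set X, IsClosed K → IsInvariantSet T K → K = ∅ ∨ K = Set.univ)
    (f : C(X, ℝ))
    (g : X → ℝ) (hg : ∀ x, Tendsto (fun n => cesaro (⇑T) (⇑f) n x) atTop (𝓝 (g x))) (x y : X) :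
    g x = g y := by
  by_contra hne
  have hpos : 0 < |g x - g y| := abs_pos.2 (sub_ne_zero.2 hne)
  obtain ⟨ε, hε, hε2⟩ : ∃ ε > 0, 5 * ε = |g x - g y| := ⟨|g x - g y| / 5, by positivity, by ring⟩
  have hinv := lim_invariant T f g hg
  let A := cesaro (⇑T) (⇑f)
  have hA : ∀ n, Continuous (A n) := cesaro_cont T f
  let E : ℕ → Set X := fun N => {z | ∀ n ≥ N, |A n z - A N z| ≤ ε}
  have hEc : ∀ N, IsClosed (E N) := by
    intro N
    simp only [E, Set.setOf_forall]
    exact isClosed_iInter fun n => isClosed_iInter fun _ =>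
      isClosed_le ((hA n).sub (hA N)).abs continuous_const
  have hEu : ⋃ N, E N = Set.univ := by
    refine Set.eq_univ_of_forall fun z => Set.mem_iUnion.2 ?_
    obtain ⟨N, hN⟩ := Metric.cauchySeq_iff'.1 (hg z).cauchySeq ε hε
    exact ⟨N, fun n hn => (hN n hn).le⟩
  haveI : Nonempty X := ⟨x⟩
  obtain ⟨N, x0, hx0⟩ := nonempty_interior_of_iUnion_of_closed hEc hEu
  have hlim : ∀ z ∈ E N, |g z - A N z| ≤ ε := by
    intro z hz
    refine le_of_tendsto ((hg z).sub_const (A N z)).abs ?_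
    filter_upwards [eventually_ge_atTop N] with n hn using hz n hn
  let U := interior (E N) ∩ {z | |A N z - A N x0| < ε}
  have hU : IsOpen U := isOpen_interior.inter
    (isOpen_lt ((hA N).sub continuous_const).abs continuous_const)
  have hUn : U.Nonempty := ⟨x0, hx0, by simpa using hε⟩
  obtain ⟨a, haU, ha⟩ := (lim_dense T hmin g hinv x).inter_open_nonempty U hU hUn
  obtain ⟨b, hbU, hb⟩ := (lim_dense T hmin g hinv y).inter_open_nonempty U hU hUn
  have h1 := hlim a (interior_subset haU.1)
  have h2 := hlim b (interior_subset hbU.1)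
  have h3 : |A N a - A N x0| < ε := haU.2
  have h4 : |A N b - A N x0| < ε := hbU.2
  simp only [Set.mem_setOf_eq] at ha hb
  rw [ha] at h1
  rw [hb] at h2
  have : |g x - g y| ≤ 4 * ε := by
    rw [abs_le] at *
    rw [abs_lt] at *
    constructor <;> linarith
  linarith

lemma integral_eq_lim {X : Type*} [MetricSpace X] [CompactSpace X]
    [MeasurableSpace X] [BorelSpace X] (T : X ≃ₜ X) (f : C(X, ℝ)) (c : ℝ)
    (hg : ∀ x, Tendsto (fun n => cesaro (⇑T) (⇑f) n x) atTop (𝓝 c))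
    (μ : ProbabilityMeasure X) (hμ : IsInvariantMeasure T μ) :
    ∫ y, f y ∂μ.toMeasure = c := by
  have hmp : MeasurePreserving (⇑T) μ.toMeasure μ.toMeasure := ⟨T.continuous.measurable, hμ⟩
  have hfint : ∀ i : ℕ, Integrable (fun x => f ((⇑T)^[i] x)) μ.toMeasure := fun i =>
    (f.continuous.comp (T.continuous.iterate i)).integrable_of_hasCompactSupport
      (HasCompactSupport.of_compactSpace _)
  have hint : ∀ n : ℕ, 1 ≤ n → ∫ y, cesaro (⇑T) (⇑f) n y ∂μ.toMeasure = ∫ y, f y ∂μ.toMeasure := by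
    intro n hn
    unfold cesaro
    rw [integral_const_mul, integral_finset_sum _ (fun i _ => hfint i)]
    have : ∀ i ∈ Finset.range n, ∫ y, f ((⇑T)^[i] y) ∂μ.toMeasure = ∫ y, f y ∂μ.toMeasure := by
      intro i _
      have hi := hmp.iterate i
      have h := integral_map (μ := μ.toMeasure) hi.measurable.aemeasurable
        (f := fun y => f y) f.continuous.aestronglyMeasurable
      rw [hi.map_eq] at h
      exact h.symm
    rw [Finset.sum_congr rfl this]
    have : (n : ℝ) ≠ 0 := by positivity
    simp [this]
  have hdom : Tendsto (fun n => ∫ y, cesaro (⇑T) (⇑f) n y ∂μ.toMeasure) atTop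
      (𝓝 (∫ _, c ∂μ.toMeasure)) := by
    refine tendsto_integral_of_dominated_convergence (fun _ => ‖f‖)
      (fun n => (cesaro_cont T f n).aestronglyMeasurable) (integrable_const _) ?_
      (Eventually.of_forall hg)
    intro n
    refine Eventually.of_forall fun y => ?_
    unfold cesaro
    rw [norm_mul, norm_inv, Real.norm_natCast]
    have h1 : ‖∑ i ∈ Finset.range n, f ((⇑T)^[i] y)‖ ≤ n * ‖f‖ := by
      refine (norm_sum_le_of_le _ (fun i _ => f.norm_coe_le_norm _)).trans ?_
      simp
    rcases Nat.eq_zero_or_pos n with rfl | hn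
    · simp
    · have : (0 : ℝ) < n := by positivity
      rw [inv_mul_le_iff₀ this]
      exact h1
  have h2 : Tendsto (fun n => ∫ y, cesaro (⇑T) (⇑f) n y ∂μ.toMeasure) atTop
      (𝓝 (∫ y, f y ∂μ.toMeasure)) := by
    refine tendsto_const_nhds.congr' ?_
    filter_upwards [eventually_ge_atTop 1] with n hn using (hint n hn).symm
  simpa using tendsto_nhds_unique h2 hdom

/-- every minimal system in which every point is generic for some invariant
measure is uniquely ergodic. -/
theorem stmt_17 {X : Type*} [MetricSpace X] [CompactSpace X] [Nonempty X]
    [MeasurableSpace X] [BorelSpace X] (T : X ≃ₜ X)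
    (hmin : ∀ K : Set X, IsClosed K → IsInvariantSet T K → K = ∅ ∨ K = Set.univ)
    (hgen : ∀ x : X, ∃ μ : MeasureTheory.ProbabilityMeasure X,
      IsInvariantMeasure T μ ∧ IsGenericFor T x μ) :
    ∃! μ : MeasureTheory.ProbabilityMeasure X, IsInvariantMeasure T μ := by
  obtain ⟨x₀⟩ := ‹Nonempty X›
  choose Φ hΦ hΦg using hgen
  refine ⟨Φ x₀, hΦ x₀, fun ν hν => ?_⟩
  apply Subtype.ext
  refine ext_of_forall_integral_eq_of_IsFiniteMeasure (μ := ν.toMeasure)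
    (ν := (Φ x₀).toMeasure) fun f => ?_
  let F : C(X, ℝ) := f.toContinuousMap
  have hc := lim_const T hmin F (fun x => ∫ y, F y ∂(Φ x).toMeasure) (fun x => hΦg x F)
  exact integral_eq_lim T F _ (fun x => by have h := hΦg x F; rwa [hc x x₀] at h) ν hν
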